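/- arXiv:2409.13210 — 5 statements merged into one kernel-verified Lean document; each statement's English description precedes it below -/
import Mathlib

section
/- Fix a natural number t, a real β > 0, a nonempty finite index set V, vectors b : V → ℝ^t, scalars c : V → ℝ, and an index j ∈ V. Then the β-softmax probability o ↦ exp(β(⟨b(j), o⟩ + c(j))) / Σ_{k∈V} exp(β(⟨b(k), o⟩ + c(k))) is quasiconcave on ℝ^t: for every α ∈ ℝ, the superlevel set {o ∈ ℝ^t | the softmax probability at o is ≥ α} is convex. -/
open RealInnerProductSpace

/-- The β-softmax probability of index `j`,
`o ↦ exp (β(⟨b j, o⟩ + c j)) / ∑ k, exp (β(⟨b k, o⟩ + c k))`,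
is quasiconcave on `ℝ^t`: every superlevel set is convex. -/
theorem softmax_quasiconcaveOn (t : ℕ) (β : ℝ) (hβ : 0 < β)
    (V : Type*) [Fintype V] [Nonempty V]
    (b : V → EuclideanSpace ℝ (Fin t)) (c : V → ℝ) (j : V) :
    QuasiconcaveOn ℝ Set.univ (fun o : EuclideanSpace ℝ (Fin t) =>
      Real.exp (β * (⟪b j, o⟫ + c j)) /
        ∑ k : V, Real.exp (β * (⟪b k, o⟫ + c k))) := by
  set g : EuclideanSpace ℝ (Fin t) → ℝ := fun o =>
    ∑ k : V, Real.exp (β * (⟪b k, o⟫ + c k) - β * (⟪b j, o⟫ + c j)) with hg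
  have hpos : ∀ o, 0 < g o := fun o =>
    Finset.sum_pos (fun k _ => Real.exp_pos _) Finset.univ_nonempty
  have heq : (fun o : EuclideanSpace ℝ (Fin t) =>
      Real.exp (β * (⟪b j, o⟫ + c j)) /
        ∑ k : V, Real.exp (β * (⟪b k, o⟫ + c k))) = fun o => (g o)⁻¹ := by
    funext o
    simp only [hg, Real.exp_sub]
    rw [← Finset.sum_div, inv_div]
  rw [heq]
  intro α x hx y hy p q hp hq hpq
  refine ⟨Set.mem_univ _, ?_⟩
  have hx' : α ≤ (g x)⁻¹ := hx.2
  have hy' : α ≤ (g y)⁻¹ := hy.2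
  show α ≤ (g (p • x + q • y))⁻¹
  rcases le_or_gt α 0 with hα | hα
  · exact hα.trans (inv_pos.mpr (hpos _)).le
  rw [le_inv_comm₀ hα (hpos _)] at hx' hy' ⊢
  have hconv : g (p • x + q • y) ≤ p * g x + q * g y := by
    simp only [hg, Finset.mul_sum]
    rw [← Finset.sum_add_distrib]
    refine Finset.sum_le_sum fun k _ => ?_
    have h := convexOn_exp.2 (Set.mem_univ (β * (⟪b k, x⟫ + c k) - β * (⟪b j, x⟫ + c j)))
      (Set.mem_univ (β * (⟪b k, y⟫ + c k) - β * (⟪b j, y⟫ + c j))) hp hq hpq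
    simp only [smul_eq_mul] at h
    refine le_trans (le_of_eq ?_) h
    congr 1
    simp only [inner_add_right, inner_smul_right]
    obtain rfl : q = 1 - p := by linarith
    ring
  calc g (p • x + q • y) ≤ p * g x + q * g y := hconv
    _ ≤ p * α⁻¹ + q * α⁻¹ := by gcongr
    _ = α⁻¹ := by rw [← add_mul, hpq, one_mul]
end

section
/- Let T, d, k be natural numbers, Q a T×d real matrix with QᵀQ invertible, A a T×k real matrix, r₀ ∈ ℝ^T, V a nonempty finite set with item vectors q : V → ℝ^d, β > 0, and j ∈ V. Define the updated user vector P(o) := (QᵀQ)⁻¹ Qᵀ (A·o + r₀), the scores s_l(o) := ⟨P(o), q(l)⟩ for l ∈ V, and the recommendation probability π_j(o) := exp(β s_j(o)) / Σ_{l∈V} exp(β s_l(o)). Then o ↦ log π_j(o) is concave on ℝ^k. -/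
open Matrix

theorem lse_aux {V : Type*} [Fintype V] [Nonempty V] (x y : V → ℝ) (a b : ℝ)
    (ha : 0 ≤ a) (hb : 0 ≤ b) (hab : a + b = 1) :
    Real.log (∑ l, Real.exp (a * x l + b * y l)) ≤
      a * Real.log (∑ l, Real.exp (x l)) + b * Real.log (∑ l, Real.exp (y l)) := by
  have pos : ∀ z : V → ℝ, 0 < ∑ l, Real.exp (z l) := fun z =>
    Finset.sum_pos (fun l _ => Real.exp_pos _) Finset.univ_nonempty
  have one : ∀ z : V → ℝ, ∑ l, Real.exp (z l - Real.log (∑ l, Real.exp (z l))) = 1 := by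
    intro z
    simp_rw [Real.exp_sub, Real.exp_log (pos z)]
    rw [← Finset.sum_div, div_self (pos z).ne']
  have hX := one x
  have hY := one y
  set X := Real.log (∑ l, Real.exp (x l))
  set Y := Real.log (∑ l, Real.exp (y l))
  rw [Real.log_le_iff_le_exp (pos _)]
  have h1 : ∑ l, Real.exp (a * (x l - X) + b * (y l - Y)) ≤ 1 := by
    calc _ ≤ ∑ l, (a * Real.exp (x l - X) + b * Real.exp (y l - Y)) :=
          Finset.sum_le_sum fun l _ => by
            simpa using convexOn_exp.2 (Set.mem_univ (x l - X)) (Set.mem_univ (y l - Y)) ha hb hab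
      _ = 1 := by
          rw [Finset.sum_add_distrib, ← Finset.mul_sum, ← Finset.mul_sum, hX, hY]; linarith
  calc _ = Real.exp (a * X + b * Y) * ∑ l, Real.exp (a * (x l - X) + b * (y l - Y)) := by
        rw [Finset.mul_sum]
        refine Finset.sum_congr rfl fun l _ => ?_
        rw [← Real.exp_add]; congr 1; ring
    _ ≤ _ := mul_le_of_le_one_right (Real.exp_pos _).le h1

/-- Proposition 1 (fixed factual trajectory): with the least-squares user-vector
update `P(o) = (QᵀQ)⁻¹ Qᵀ (A·o + r₀)`, scores `s l o = ⟨P(o), q l⟩` and the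
β-softmax recommendation probability
`π_j(o) = exp (β s_j(o)) / ∑ l, exp (β s_l(o))`, the map `o ↦ log π_j(o)` is
concave on `ℝ^k`. -/
theorem log_recommendation_prob_concaveOn (T d k : ℕ)
    (Q : Matrix (Fin T) (Fin d) ℝ) (hQ : IsUnit (Q.transpose * Q))
    (A : Matrix (Fin T) (Fin k) ℝ) (r₀ : Fin T → ℝ)
    (V : Type*) [Fintype V] [Nonempty V] (q : V → (Fin d → ℝ))
    (β : ℝ) (hβ : 0 < β) (j : V)
    (P : (Fin k → ℝ) → (Fin d → ℝ))
    (hP : ∀ o : Fin k → ℝ,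
      P o = (Q.transpose * Q)⁻¹.mulVec (Q.transpose.mulVec (A.mulVec o + r₀)))
    (s : V → (Fin k → ℝ) → ℝ)
    (hs : ∀ (l : V) (o : Fin k → ℝ), s l o = P o ⬝ᵥ q l)
    (π : V → (Fin k → ℝ) → ℝ)
    (hπ : ∀ (l : V) (o : Fin k → ℝ),
      π l o = Real.exp (β * s l o) / ∑ l' : V, Real.exp (β * s l' o)) :
    ConcaveOn ℝ Set.univ (fun o : Fin k → ℝ => Real.log (π j o)) := by
  have hlog : ∀ o, Real.log (π j o) =
      β * s j o - Real.log (∑ l, Real.exp (β * s l o)) := by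
    intro o
    have pos : 0 < ∑ l, Real.exp (β * s l o) :=
      Finset.sum_pos (fun l _ => Real.exp_pos _) Finset.univ_nonempty
    rw [hπ, Real.log_div (Real.exp_pos _).ne' pos.ne', Real.log_exp]
  refine ⟨convex_univ, ?_⟩
  intro x _ y _ a b ha hb hab
  have hs' : ∀ l, β * s l (a • x + b • y) = a * (β * s l x) + b * (β * s l y) := by
    intro l
    have hr : A.mulVec (a • x + b • y) + r₀ =
        a • (A.mulVec x + r₀) + b • (A.mulVec y + r₀) := by
      have : r₀ = a • r₀ + b • r₀ := by rw [← add_smul, hab, one_smul]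
      rw [Matrix.mulVec_add, Matrix.mulVec_smul, Matrix.mulVec_smul, smul_add, smul_add]
      nth_rw 1 [this]
      abel
    have hPl : P (a • x + b • y) = a • P x + b • P y := by
      simp only [hP]
      rw [hr]
      simp only [Matrix.mulVec_add (_ : Matrix _ _ ℝ) (a • _) (b • _), Matrix.mulVec_smul]
    rw [hs, hs, hs, hPl, add_dotProduct, smul_dotProduct, smul_dotProduct, smul_eq_mul,
      smul_eq_mul]
    ring
  have key := lse_aux (fun l => β * s l x) (fun l => β * s l y) a b ha hb hab
  simp only [hlog, hs', smul_eq_mul]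
  linarith
end

section
/- Let n be a natural number and f : ℝ^n → ℝ (i.e., EuclideanSpace ℝ (Fin n) → ℝ) be convex on all of ℝ^n and have exactly one root, i.e., there exists a unique x₀ ∈ ℝ^n with f(x₀) = 0. Then g(x) := (f(x))² is quasiconvex on ℝ^n: for every α ∈ ℝ, the sublevel set {x ∈ ℝ^n | (f(x))² ≤ α} is convex. -/
lemma root_on_ray (n : ℕ) (f : EuclideanSpace ℝ (Fin n) → ℝ)
    (hf : ConvexOn ℝ Set.univ f) (z x : EuclideanSpace ℝ (Fin n))
    (hz : f z < 0) (hx : f z < f x) : ∃ t : ℝ, 0 < t ∧ f (z + t • (x - z)) = 0 := by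
  have hc : Continuous f := by
    have := hf.continuousOn isOpen_univ
    exact continuousOn_univ.mp this
  have hd : 0 < f x - f z := by linarith
  obtain ⟨T, hT⟩ : ∃ T : ℝ, T = 1 + (-f z) / (f x - f z) := ⟨_, rfl⟩
  have hq : 0 < (-f z) / (f x - f z) := div_pos (by linarith) hd
  have hT1 : 1 < T := by linarith
  have hT0 : 0 < T := by linarith
  have hTm : T * (f x - f z) = f x - f z - f z := by
    rw [hT]; field_simp; ring
  have hinv : T⁻¹ ≤ 1 := inv_le_one_of_one_le₀ hT1.le
  have h := hf.2 (Set.mem_univ z) (Set.mem_univ (z + T • (x - z)))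
    (sub_nonneg.mpr hinv) (inv_nonneg.mpr hT0.le) (by ring)
  have he : (1 - T⁻¹) • z + T⁻¹ • (z + T • (x - z)) = x := by
    rw [smul_add, smul_smul, inv_mul_cancel₀ hT0.ne']
    module
  rw [he] at h
  simp only [smul_eq_mul] at h
  have h2 : T * f x ≤ (T - 1) * f z + f (z + T • (x - z)) := by
    have := mul_le_mul_of_nonneg_left h hT0.le
    have e : T * ((1 - T⁻¹) * f z + T⁻¹ * f (z + T • (x - z)))
        = (T - 1) * f z + f (z + T • (x - z)) := by field_simp
    linarith
  have hpos : 0 ≤ f (z + T • (x - z)) := by linarith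
  have hcφ : Continuous (fun t : ℝ => f (z + t • (x - z))) := by fun_prop
  obtain ⟨t, ht, hft⟩ := intermediate_value_Icc hT0.le hcφ.continuousOn
    (show (0 : ℝ) ∈ Set.Icc _ _ from ⟨by simpa using hz.le, hpos⟩)
  refine ⟨t, lt_of_le_of_ne ht.1 ?_, hft⟩
  rintro rfl
  simp at hft
  linarith

/-- Lemma 1 (Appendix): if `f : ℝ^n → ℝ` is convex with exactly one root, then
`g = f²` is quasiconvex: every sublevel set is convex. -/
theorem sq_of_convex_unique_root_quasiconvexOn (n : ℕ)
    (f : EuclideanSpace ℝ (Fin n) → ℝ)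
    (hf : ConvexOn ℝ Set.univ f)
    (hroot : ∃! x₀ : EuclideanSpace ℝ (Fin n), f x₀ = 0) :
    QuasiconvexOn ℝ Set.univ (fun x => (f x) ^ 2) := by
  rintro α x ⟨-, hx⟩ y ⟨-, hy⟩ a b ha hb hab
  refine ⟨Set.mem_univ _, ?_⟩
  have hx := Real.abs_le_sqrt hx
  have hy := Real.abs_le_sqrt hy
  have hα : 0 ≤ α := le_trans (sq_nonneg (f x)) (by assumption)
  show f (a • x + b • y) ^ 2 ≤ α
  rw [← Real.sq_sqrt hα]
  obtain ⟨c, hc⟩ : ∃ c, c = √α := ⟨_, rfl⟩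
  have hc0 : 0 ≤ c := hc ▸ Real.sqrt_nonneg α
  rw [← hc] at hx hy ⊢
  rw [abs_le] at hx hy
  have hle := hf.2 (Set.mem_univ x) (Set.mem_univ y) ha hb hab
  simp only [smul_eq_mul] at hle
  apply sq_le_sq'
  · by_contra! hlt
    obtain ⟨z, hzdef⟩ : ∃ z, z = a • x + b • y := ⟨_, rfl⟩
    rw [← hzdef] at hlt
    have hz : f z < 0 := by linarith
    obtain ⟨t, ht, h1⟩ := root_on_ray n f hf z x hz (by linarith)
    obtain ⟨s, hs, h2⟩ := root_on_ray n f hf z y hz (by linarith)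
    have heq := hroot.unique h1 h2
    have hb' : b = 1 - a := by linarith
    have h3 : (t * b + s * a) • (x - y) = 0 := by
      have : (t * b + s * a) • (x - y) = (z + t • (x - z)) - (z + s • (y - z)) := by
        rw [hzdef, hb']; module
      rw [this, heq, sub_self]
    have hp : 0 < t * b + s * a := by
      rcases ha.eq_or_lt with h | h
      · have : b = 1 := by linarith
        rw [← h, this]; simpa using ht
      · have := mul_nonneg ht.le hb
        have := mul_pos hs h
        linarith
    have hxy : x = y := sub_eq_zero.mp ((smul_eq_zero.mp h3).resolve_left hp.ne')
    have : z = x := by rw [hzdef, ← hxy, ← add_smul, hab, one_smul]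
    rw [this] at hlt
    linarith
  · nlinarith [mul_le_mul_of_nonneg_left hx.2 ha, mul_le_mul_of_nonneg_left hy.2 hb]
end

section
/- Let n be a natural number and f : ℝ^n → ℝ (i.e., EuclideanSpace ℝ (Fin n) → ℝ) be convex on all of ℝ^n and have exactly one root, i.e., there exists a unique x₀ ∈ ℝ^n with f(x₀) = 0. Then for every α > 0, the set {x ∈ ℝ^n | −√α ≤ f(x) ≤ √α} is convex. -/
theorem ray_root (n : ℕ) (f : EuclideanSpace ℝ (Fin n) → ℝ)
    (hf : ConvexOn ℝ Set.univ f) (z a : EuclideanSpace ℝ (Fin n))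
    (hz : f z < 0) (hza : f z < f a) : ∃ t : ℝ, 0 < t ∧ f (z + t • (a - z)) = 0 := by
  have hc : Continuous f := by
    have := hf.continuousOn isOpen_univ
    rwa [continuousOn_univ] at this
  have hd : 0 < f a - f z := sub_pos.2 hza
  set T : ℝ := 1 + (-f z) / (f a - f z) with hT
  have hT1 : 1 < T := by
    have : 0 < (-f z) / (f a - f z) := div_pos (by linarith) hd
    linarith
  have hT0 : 0 < T := by linarith
  have hTm : (T - 1) * (f a - f z) = - f z := by
    rw [hT]; field_simp; ring
  have hpos : 0 ≤ f (z + T • (a - z)) := by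
    have h := hf.2 (Set.mem_univ z) (Set.mem_univ (z + T • (a - z)))
      (show (0:ℝ) ≤ 1 - 1 / T by rw [sub_nonneg, div_le_one hT0]; exact hT1.le)
      (show (0:ℝ) ≤ 1 / T by positivity) (by ring)
    have e : (1 - 1 / T) • z + (1 / T) • (z + T • (a - z)) = a := by
      rw [smul_add, smul_smul, one_div_mul_cancel hT0.ne']; module
    rw [e] at h
    simp only [smul_eq_mul] at h
    have h2 := mul_le_mul_of_nonneg_left h hT0.le
    have e2 : T * ((1 - 1 / T) * f z + 1 / T * f (z + T • (a - z)))
        = (T - 1) * f z + f (z + T • (a - z)) := by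
      field_simp
    rw [e2] at h2
    nlinarith
  have hg : Continuous (fun t : ℝ => f (z + t • (a - z))) := by fun_prop
  obtain ⟨t, ht, h0⟩ := intermediate_value_Icc hT0.le hg.continuousOn
    (show (0:ℝ) ∈ Set.Icc _ _ from ⟨by simpa using hz.le, hpos⟩)
  refine ⟨t, lt_of_le_of_ne ht.1 ?_, h0⟩
  rintro rfl
  simp at h0
  linarith

/-- Key sublevel-set computation in Lemma 1 (Appendix): if `f : ℝ^n → ℝ` is
convex with exactly one root, then for every `α > 0` the set
`{x | −√α ≤ f x ≤ √α}` is convex. -/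
theorem band_convex_of_convex_unique_root (n : ℕ)
    (f : EuclideanSpace ℝ (Fin n) → ℝ)
    (hf : ConvexOn ℝ Set.univ f)
    (hroot : ∃! x₀ : EuclideanSpace ℝ (Fin n), f x₀ = 0) :
    ∀ α : ℝ, 0 < α →
      Convex ℝ {x : EuclideanSpace ℝ (Fin n) |
        -Real.sqrt α ≤ f x ∧ f x ≤ Real.sqrt α} := by
  intro α hα a ha b hb u v hu hv huv
  have hs : 0 < Real.sqrt α := Real.sqrt_pos.2 hα
  obtain ⟨ha1, ha2⟩ := ha
  obtain ⟨hb1, hb2⟩ := hb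
  have hup : f (u • a + v • b) ≤ Real.sqrt α := by
    have h := hf.2 (Set.mem_univ a) (Set.mem_univ b) hu hv huv
    simp only [smul_eq_mul] at h
    nlinarith
  refine ⟨?_, hup⟩
  by_contra! hlt
  obtain ⟨t, ht, h1⟩ := ray_root n f hf (u • a + v • b) a (by linarith) (by linarith)
  obtain ⟨r, hr, h2⟩ := ray_root n f hf (u • a + v • b) b (by linarith) (by linarith)
  have heq := hroot.unique h1 h2
  obtain rfl : u = 1 - v := by linarith
  have hk : (t * v + r * (1 - v)) • (a - b) = 0 := by
    rw [← sub_eq_zero] at heq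
    rw [← heq]
    module
  have hpos : 0 < t * v + r * (1 - v) := by
    rcases hv.eq_or_lt with h | h
    · subst h; simpa using hr
    · have := mul_pos ht h
      have := mul_nonneg hr.le hu
      linarith
  have hab : a = b := by
    rcases smul_eq_zero.1 hk with h | h
    · exact absurd h hpos.ne'
    · exact sub_eq_zero.1 h
  subst hab
  have : (1 - v) • a + v • a = a := by module
  rw [this] at hlt
  linarith
end

section
/- Let n be a natural number, s a nonempty compact convex subset of ℝ^n (EuclideanSpace ℝ (Fin n)), and f : ℝ^n → ℝ a function that is continuous on s and quasiconvex on s. Then there exists an extreme point e of s such that f(x) ≤ f(e) for all x ∈ s; i.e., f attains its maximum over s at an extreme point of s. -/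
theorem minkowski_aux (k : ℕ) : ∀ (E : Type) [NormedAddCommGroup E] [NormedSpace ℝ E]
    [FiniteDimensional ℝ E] (_ : Module.finrank ℝ E = k) (s : Set E) (_ : IsCompact s)
    (_ : Convex ℝ s), s ⊆ convexHull ℝ (s.extremePoints ℝ) := by
  induction k using Nat.strong_induction_on with
  | _ k ih =>
  intro E _ _ _ hk s hs hc x hx
  by_contra hxC
  have hcl := closure_convexHull_extremePoints hs hc
  set C := convexHull ℝ (s.extremePoints ℝ) with hC
  have hCc : Convex ℝ C := convex_convexHull _ _
  have key : ∃ l : StrongDual ℝ E, l ≠ 0 ∧ ∀ a ∈ C, l a ≤ l x := by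
    by_cases hi : (interior C).Nonempty
    · exact geometric_hahn_banach_of_nonempty_interior_point hCc
        (fun h => hxC (interior_subset h)) hi
    · rw [hCc.interior_nonempty_iff_affineSpan_eq_top] at hi
      have hCn : C.Nonempty := by
        obtain ⟨y, hy⟩ := hs.extremePoints_nonempty ⟨x, hx⟩
        exact ⟨y, subset_convexHull _ _ hy⟩
      have hv : vectorSpan ℝ C < ⊤ := by
        rw [lt_top_iff_ne_top]
        intro h
        exact hi ((AffineSubspace.affineSpan_eq_top_iff_vectorSpan_eq_top_of_nonempty ℝ E E hCn).2 h)
      obtain ⟨l, hl0, hl⟩ := Submodule.exists_le_ker_of_lt_top _ hv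
      obtain ⟨y, hy⟩ := hCn
      have hconst : ∀ a ∈ C, l a = l y := by
        intro a ha
        have := hl (vsub_mem_vectorSpan ℝ ha hy)
        simpa [sub_eq_zero] using this
      refine ⟨LinearMap.toContinuousLinearMap l, by simpa using hl0, ?_⟩
      have : s ⊆ {z | LinearMap.toContinuousLinearMap l z = l y} := by
        rw [← hcl]
        exact closure_minimal hconst (isClosed_eq (by fun_prop) continuous_const)
      intro a ha
      have h1 := this hx
      have h2 := hconst a ha
      simp only [Set.mem_ofPred_eq] at h1
      rw [h1]
      exact h2.le
  obtain ⟨l, hl0, hl⟩ := key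
  have hls : ∀ a ∈ s, l a ≤ l x := by
    have : s ⊆ {z | l z ≤ l x} := by
      rw [← hcl]
      exact closure_minimal hl (isClosed_le (by fun_prop) continuous_const)
    exact this
  let K := LinearMap.ker l.toLinearMap
  have hKlt : Module.finrank ℝ K < k := by
    rw [← hk]
    apply Submodule.finrank_lt
    intro h
    apply hl0
    ext v
    have : v ∈ K := by rw [h]; trivial
    simpa [K] using this
  let φ : K →ᵃ[ℝ] E := K.subtype.toAffineMap + AffineMap.const ℝ K x
  have hφ : ∀ v : K, φ v = v + x := fun v => by simp [φ]
  have hlφ : ∀ v : K, l (φ v) = l x := fun v => by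
    have : l (v : E) = 0 := v.2
    simp [hφ, this]
  have hinj : Function.Injective φ := fun a b h => by
    rw [hφ, hφ] at h
    exact Subtype.ext (add_right_cancel h)
  have hemb : Topology.IsClosedEmbedding φ := by
    have h1 : Topology.IsClosedEmbedding ((↑) : K → E) :=
      K.closed_of_finiteDimensional.isClosedEmbedding_subtypeVal
    have h2 := (Homeomorph.addRight x).isClosedEmbedding.comp h1
    have h3 : (φ : K → E) = (Homeomorph.addRight x) ∘ Subtype.val := by
      funext v
      simp [hφ]
    rw [h3]
    exact h2
  have hsub := ih _ hKlt K rfl (φ ⁻¹' s) (hemb.isCompact_preimage hs) (hc.affine_preimage φ)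
  have h0 : (0 : K) ∈ φ ⁻¹' s := by simpa [hφ] using hx
  have h1 := Set.mem_image_of_mem φ (hsub h0)
  rw [AffineMap.image_convexHull] at h1
  apply hxC
  have h2 : φ 0 = x := by simp [hφ]
  rw [h2] at h1
  refine convexHull_mono ?_ h1
  rintro _ ⟨v, hv, rfl⟩
  refine ⟨hv.1, ?_⟩
  intro y hy z hz hyz
  have hly := hls y hy
  have hlz := hls z hz
  have hyz' := hyz
  obtain ⟨a, b, ha, hb, hab, he⟩ := hyz'
  have hle : a * l y + b * l z = l x := by
    rw [← hlφ v, ← he]; simp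
  have hxx : l x = a * l x + b * l x := by rw [← add_mul, hab, one_mul]
  have hy1 : l y = l x := by
    apply le_antisymm hly
    by_contra! hlt
    nlinarith [mul_lt_mul_of_pos_left hlt ha, mul_le_mul_of_nonneg_left hlz hb.le]
  have hz1 : l z = l x := by
    apply le_antisymm hlz
    by_contra! hlt
    nlinarith [mul_lt_mul_of_pos_left hlt hb, mul_le_mul_of_nonneg_left hly ha.le]
  obtain ⟨y', rfl⟩ : ∃ y' : K, φ y' = y := ⟨⟨y - x, by simp [K, hy1]⟩, by simp [hφ]⟩
  obtain ⟨z', rfl⟩ : ∃ z' : K, φ z' = z := ⟨⟨z - x, by simp [K, hz1]⟩, by simp [hφ]⟩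
  have : v ∈ openSegment ℝ y' z' := by
    rw [← image_openSegment] at hyz
    obtain ⟨w, hw, hwv⟩ := hyz
    rwa [← hinj hwv]
  rw [hv.2 hy hz this]

/-- A function continuous and quasiconvex on a nonempty compact convex subset
of `ℝ^n` attains its maximum over the set at an extreme point. -/
theorem quasiconvexOn_exists_max_extremePoint (n : ℕ)
    (s : Set (EuclideanSpace ℝ (Fin n)))
    (hne : s.Nonempty) (hcomp : IsCompact s) (hconv : Convex ℝ s)
    (f : EuclideanSpace ℝ (Fin n) → ℝ)
    (hcont : ContinuousOn f s) (hqc : QuasiconvexOn ℝ s f) :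
    ∃ e ∈ Set.extremePoints ℝ s, ∀ x ∈ s, f x ≤ f e := by
  obtain ⟨x, hx, hmax⟩ := hcomp.exists_isMaxOn hne hcont
  by_contra! hcon
  have hlt : ∀ e ∈ Set.extremePoints ℝ s, f e < f x := fun e he => by
    obtain ⟨y, hy, h⟩ := hcon e he
    exact h.trans_le (hmax hy)
  have hL : Convex ℝ {y ∈ s | f y < f x} := hqc.convex_lt (f x)
  have hsub : Set.extremePoints ℝ s ⊆ {y ∈ s | f y < f x} := fun e he => ⟨he.1, hlt e he⟩
  have := convexHull_min hsub hL
    (minkowski_aux _ _ rfl s hcomp hconv hx)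
  exact lt_irrefl _ this.2
end
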